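/- (Factorization of graded decomposition maps.) Let A be an integral domain, integrally closed in its field of fractions K, and H a Z-graded associative A-algebra, finitely generated and free over A. Let θ : A → L and θ' : A → L' be ring homomorphisms into fields such that L is the field of fractions of θ(A), L' is the field of fractions of θ'(A), and Ker(θ) ⊆ Ker(θ'). Let φ : θ(A) → L' be the induced homomorphism with φ ∘ θ = θ', and assume φ extends to a ring B with θ(A) ⊆ B ⊆ L that is integrally closed in L. Assume the algebras LH and L'H are split. Then the graded decomposition maps satisfy d^gr_{θ'} = d^gr_{θ,θ'} ∘ d^gr_θ as maps R_0^+(KH) → R_0^+(L'H). -/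

import Mathlib

universe u

open DirectSum Function

/-! ## Modules over `S ⊗_A H`

For an `A`-algebra `H` and a commutative `A`-algebra `S`, a (finitely generated) module over
the `S`-algebra `S ⊗_A H` is the same thing as an `S`-module together with a commuting
`H`-action such that the two induced `A`-actions agree.  We package this data in a structure. -/

structure ModPkg (A : Type u) [CommRing A] (H : Type u) [Ring H] [Algebra A H]
    (S : Type u) [CommRing S] [Algebra A S] : Type (u + 1) where
  carrier : Type u
  [acg : AddCommGroup carrier]
  [modS : Module S carrier]
  [modH : Module H carrier]
  smul_comm' : ∀ (h : H) (s : S) (x : carrier), h • s • x = s • h • x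
  compat : ∀ (a : A) (x : carrier), (algebraMap A H a) • x = (algebraMap A S a) • x
  [fin : Module.Finite S carrier]

attribute [instance] ModPkg.acg ModPkg.modS ModPkg.modH ModPkg.fin

section Ungraded

variable {A : Type u} [CommRing A] {H : Type u} [Ring H] [Algebra A H]
  {S : Type u} [CommRing S] [Algebra A S]

namespace ModPkg

/-- A subgroup stable under both scalar actions, i.e. an `S ⊗_A H`-submodule. -/
def IsStable (M : ModPkg A H S) (p : AddSubgroup M.carrier) : Prop :=
  (∀ (s : S), ∀ x ∈ p, s • x ∈ p) ∧ (∀ (h : H), ∀ x ∈ p, h • x ∈ p)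

/-- Simplicity of an `S ⊗_A H`-module. -/
def Simple (M : ModPkg A H S) : Prop :=
  Nontrivial M.carrier ∧ ∀ p : AddSubgroup M.carrier, M.IsStable p → p = ⊥ ∨ p = ⊤

/-- Isomorphism of `S ⊗_A H`-modules. -/
def Iso (M N : ModPkg A H S) : Prop :=
  ∃ e : M.carrier ≃+ N.carrier,
    (∀ (s : S) (x : M.carrier), e (s • x) = s • e x) ∧
    (∀ (h : H) (x : M.carrier), e (h • x) = h • e x)

/-- The action of an element of `H` as an `S`-linear endomorphism. -/
noncomputable def act (M : ModPkg A H S) (h : H) : M.carrier →ₗ[S] M.carrier where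
  toFun x := h • x
  map_add' x y := smul_add h x y
  map_smul' s x := by simpa using M.smul_comm' h s x

/-- The character of an `S ⊗_A H`-module, as a function on `H`. -/
noncomputable def char (M : ModPkg A H S) : H → S :=
  fun h => LinearMap.trace S M.carrier (M.act h)

/-- The factor `q/p` is isomorphic to `M` (as `S ⊗_A H`-modules), witnessed by a surjection
`q → M` with kernel `p`. -/
def IsFactor (V : ModPkg A H S) (p q : AddSubgroup V.carrier) (M : ModPkg A H S) : Prop :=
  ∃ φ : q →+ M.carrier,
    Surjective φ ∧
    (∀ x : q, φ x = 0 ↔ (x : V.carrier) ∈ p) ∧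
    (∀ (s : S) (x y : q), (y : V.carrier) = s • (x : V.carrier) → φ y = s • φ x) ∧
    (∀ (h : H) (x y : q), (y : V.carrier) = h • (x : V.carrier) → φ y = h • φ x)

end ModPkg

/-- An (ungraded) composition series of an `S ⊗_A H`-module. -/
structure CompSeries (V : ModPkg A H S) : Type u where
  len : ℕ
  c : Fin (len + 1) → AddSubgroup V.carrier
  mono : ∀ t : Fin len, c t.castSucc ≤ c t.succ
  bot : c 0 = ⊥
  top : c (Fin.last len) = ⊤
  stable : ∀ t, V.IsStable (c t)
  steps : ∀ t : Fin len, c t.castSucc ≠ c t.succ ∧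
    ∀ p : AddSubgroup V.carrier, V.IsStable p → c t.castSucc ≤ p → p ≤ c t.succ →
      p = c t.castSucc ∨ p = c t.succ

/-- The multiplicity of the simple module `M` in a composition series. -/
noncomputable def ModPkg.mult (V : ModPkg A H S) (cs : CompSeries V) (M : ModPkg A H S) : ℕ :=
  Nat.card { t : Fin cs.len // V.IsFactor (cs.c t.castSucc) (cs.c t.succ) M }

end Ungraded

/-- The algebra `S ⊗_A H` is split: the endomorphism algebra of every simple module is `S`. -/
def SplitAlg (A : Type u) [CommRing A] (H : Type u) [Ring H] [Algebra A H]
    (S : Type u) [CommRing S] [Algebra A S] : Prop :=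
  ∀ M : ModPkg A H S, M.Simple →
    ∀ f : M.carrier →+ M.carrier,
      (∀ (s : S) (x : M.carrier), f (s • x) = s • f x) →
      (∀ (h : H) (x : M.carrier), f (h • x) = h • f x) →
      ∃ s : S, ∀ x, f x = s • x

/-- The set of irreducible characters of `S ⊗_A H`. -/
def IrrChars (A : Type u) [CommRing A] (H : Type u) [Ring H] [Algebra A H]
    (S : Type u) [CommRing S] [Algebra A S] : Set (H → S) :=
  { χ | ∃ M : ModPkg A H S, M.Simple ∧ χ = M.char }

/-! ## Graded modules over `S ⊗_A H` for a `ℤ`-graded algebra `H = ⊕ 𝒜 i` -/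

structure GrMod (A : Type u) [CommRing A] (H : Type u) [Ring H] [Algebra A H]
    (𝒜 : ℤ → Submodule A H) (S : Type u) [CommRing S] [Algebra A S] : Type (u + 1) where
  carrier : Type u
  [acg : AddCommGroup carrier]
  [modS : Module S carrier]
  [modH : Module H carrier]
  smul_comm' : ∀ (h : H) (s : S) (x : carrier), h • s • x = s • h • x
  compat : ∀ (a : A) (x : carrier), (algebraMap A H a) • x = (algebraMap A S a) • x
  [fin : Module.Finite S carrier]
  grading : ℤ → Submodule S carrier
  [decomp : DirectSum.Decomposition grading]
  grading_smul : ∀ (i j : ℤ) (h : H), h ∈ 𝒜 i → ∀ x ∈ grading j, h • x ∈ grading (i + j)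

attribute [instance] GrMod.acg GrMod.modS GrMod.modH GrMod.fin GrMod.decomp

section Graded

variable {A : Type u} [CommRing A] {H : Type u} [Ring H] [Algebra A H]
  {𝒜 : ℤ → Submodule A H} {S : Type u} [CommRing S] [Algebra A S]

namespace GrMod

/-- The underlying ungraded module of a graded module. -/
def forget (V : GrMod A H 𝒜 S) : ModPkg A H S where
  carrier := V.carrier
  acg := V.acg
  modS := V.modS
  modH := V.modH
  smul_comm' := V.smul_comm'
  compat := V.compat
  fin := V.fin

/-- The action of a degree-`0` element of `H` on the degree-`i` piece of a graded module,
as an `S`-linear endomorphism; this is the representation `ρ_{V_i}` restricted to `H_0`. -/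
noncomputable def degAct (V : GrMod A H 𝒜 S) (h : 𝒜 0) (i : ℤ) :
    V.grading i →ₗ[S] V.grading i where
  toFun x := ⟨(h : H) • (x : V.carrier), by
    simpa using V.grading_smul 0 i (h : H) h.2 (x : V.carrier) x.2⟩
  map_add' x y := by
    apply Subtype.ext
    simp [smul_add]
  map_smul' s x := by
    apply Subtype.ext
    simpa using V.smul_comm' (h : H) s (x : V.carrier)

/-- A subgroup which is an `S ⊗_A H`-submodule and is graded. -/
def IsGrSub (V : GrMod A H 𝒜 S) (p : AddSubgroup V.carrier) : Prop :=
  V.forget.IsStable p ∧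
    ∀ x ∈ p, ∀ i : ℤ, ((DirectSum.decompose V.grading x i : V.grading i) : V.carrier) ∈ p

/-- A graded module is graded-simple if it is nonzero and has no nontrivial graded submodule. -/
def GrSimple (V : GrMod A H 𝒜 S) : Prop :=
  Nontrivial V.carrier ∧ ∀ p : AddSubgroup V.carrier, V.IsGrSub p → p = ⊥ ∨ p = ⊤

/-- Isomorphism of graded modules. -/
def GrIso (V W : GrMod A H 𝒜 S) : Prop :=
  ∃ e : V.carrier ≃+ W.carrier,
    (∀ (s : S) (x : V.carrier), e (s • x) = s • e x) ∧
    (∀ (h : H) (x : V.carrier), e (h • x) = h • e x) ∧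
    (∀ (i : ℤ), ∀ x ∈ V.grading i, e x ∈ W.grading i)

/-- `W` is the shift `V⟨j⟩` of `V`, i.e. `W_i = V_{i-j}`. -/
def IsShiftOf (W V : GrMod A H 𝒜 S) (j : ℤ) : Prop :=
  ∃ e : W.carrier ≃+ V.carrier,
    (∀ (s : S) (x : W.carrier), e (s • x) = s • e x) ∧
    (∀ (h : H) (x : W.carrier), e (h • x) = h • e x) ∧
    (∀ (i : ℤ), ∀ x ∈ W.grading i, e x ∈ V.grading (i - j))

/-- The factor `q/p` of a graded module is isomorphic, as a graded module, to the shift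
`M⟨n⟩` of `M`. -/
def IsFactorShift (V : GrMod A H 𝒜 S) (p q : AddSubgroup V.carrier)
    (M : GrMod A H 𝒜 S) (n : ℤ) : Prop :=
  ∃ φ : q →+ M.carrier,
    Surjective φ ∧
    (∀ x : q, φ x = 0 ↔ (x : V.carrier) ∈ p) ∧
    (∀ (s : S) (x y : q), (y : V.carrier) = s • (x : V.carrier) → φ y = s • φ x) ∧
    (∀ (h : H) (x y : q), (y : V.carrier) = h • (x : V.carrier) → φ y = h • φ x) ∧
    (∀ (i : ℤ) (x : q), (x : V.carrier) ∈ V.grading i → φ x ∈ M.grading (i - n)) ∧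
    (∀ (i : ℤ), ∀ m ∈ M.grading (i - n), ∃ x : q, (x : V.carrier) ∈ V.grading i ∧ φ x = m)

end GrMod

/-- A graded composition series of a graded module. -/
structure GrCompSeries (V : GrMod A H 𝒜 S) : Type u where
  len : ℕ
  c : Fin (len + 1) → AddSubgroup V.carrier
  mono : ∀ t : Fin len, c t.castSucc ≤ c t.succ
  bot : c 0 = ⊥
  top : c (Fin.last len) = ⊤
  graded : ∀ t, V.IsGrSub (c t)
  steps : ∀ t : Fin len, c t.castSucc ≠ c t.succ ∧
    ∀ p : AddSubgroup V.carrier, V.IsGrSub p → c t.castSucc ≤ p → p ≤ c t.succ →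
      p = c t.castSucc ∨ p = c t.succ

/-- The multiplicity `[V : M⟨n⟩]^gr` of the shifted graded simple module `M⟨n⟩` in a graded
composition series of `V`. -/
noncomputable def GrMod.multShift (V : GrMod A H 𝒜 S) (cs : GrCompSeries V)
    (M : GrMod A H 𝒜 S) (n : ℤ) : ℕ :=
  Nat.card { t : Fin cs.len // V.IsFactorShift (cs.c t.castSucc) (cs.c t.succ) M n }

/-- The graded decomposition number `∑_n q^n [V : M⟨n⟩]^gr ∈ ℕ[q,q⁻¹]`. -/
noncomputable def GrMod.entryPoly (V : GrMod A H 𝒜 S) (cs : GrCompSeries V)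
    (M : GrMod A H 𝒜 S) : LaurentPolynomial ℕ :=
  ∑ᶠ n : ℤ, (V.multShift cs M n) • LaurentPolynomial.T n

/-- A short exact sequence of graded modules (morphisms are of degree `0`). -/
structure GrSES (X Y Z : GrMod A H 𝒜 S) : Type u where
  f : X.carrier →+ Y.carrier
  g : Y.carrier →+ Z.carrier
  f_smulS : ∀ (s : S) (x : X.carrier), f (s • x) = s • f x
  f_smulH : ∀ (h : H) (x : X.carrier), f (h • x) = h • f x
  g_smulS : ∀ (s : S) (y : Y.carrier), g (s • y) = s • g y
  g_smulH : ∀ (h : H) (y : Y.carrier), g (h • y) = h • g y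
  inj : Injective f
  surj : Surjective g
  exact : ∀ y : Y.carrier, g y = 0 ↔ ∃ x, f x = y
  f_graded : ∀ (i : ℤ), ∀ x ∈ X.grading i, f x ∈ Y.grading i
  g_graded : ∀ (i : ℤ), ∀ y ∈ Y.grading i, g y ∈ Z.grading i

end Graded

/-- The defining relations of the Grothendieck group of finite-dimensional graded modules. -/
def grRelSet (A : Type u) [CommRing A] (H : Type u) [Ring H] [Algebra A H]
    (𝒜 : ℤ → Submodule A H) (S : Type u) [CommRing S] [Algebra A S] :
    Set (FreeAbelianGroup (GrMod A H 𝒜 S)) :=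
  { z | ∃ X Y Z : GrMod A H 𝒜 S, Nonempty (GrSES X Y Z) ∧
      z = FreeAbelianGroup.of Y - FreeAbelianGroup.of X - FreeAbelianGroup.of Z }

/-- The Grothendieck group `R_0(S ⊗_A H)` of finite-dimensional graded modules. -/
def Groth (A : Type u) [CommRing A] (H : Type u) [Ring H] [Algebra A H]
    (𝒜 : ℤ → Submodule A H) (S : Type u) [CommRing S] [Algebra A S] : Type (u + 1) :=
  FreeAbelianGroup (GrMod A H 𝒜 S) ⧸ AddSubgroup.closure (grRelSet A H 𝒜 S)

noncomputable instance (A : Type u) [CommRing A] (H : Type u) [Ring H] [Algebra A H]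
    (𝒜 : ℤ → Submodule A H) (S : Type u) [CommRing S] [Algebra A S] :
    AddCommGroup (Groth A H 𝒜 S) :=
  inferInstanceAs
    (AddCommGroup (FreeAbelianGroup (GrMod A H 𝒜 S) ⧸ AddSubgroup.closure (grRelSet A H 𝒜 S)))

/-- The class `[V]` of a graded module in the Grothendieck group; `R_0^+` is the set of
all such classes. -/
def GrMod.cls {A : Type u} [CommRing A] {H : Type u} [Ring H] [Algebra A H]
    {𝒜 : ℤ → Submodule A H} {S : Type u} [CommRing S] [Algebra A S]
    (V : GrMod A H 𝒜 S) : Groth A H 𝒜 S :=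
  QuotientAddGroup.mk (FreeAbelianGroup.of V)

section Char

variable {A : Type u} [CommRing A] {H : Type u} [Ring H] [Algebra A H]
  {𝒜 : ℤ → Submodule A H} {S : Type u} [CommRing S] [Algebra A S]

/-- The graded character of a graded module, as a function `H → S[t,t⁻¹]`:
it vanishes on the components of degree `≠ 0` and sends `h₀ ∈ H_0` to
`∑_i t^i χ_{V_i}(h₀)`. -/
noncomputable def GrMod.grChar [DirectSum.Decomposition 𝒜] (V : GrMod A H 𝒜 S) :
    H → LaurentPolynomial S :=
  fun h => ∑ᶠ i : ℤ, LaurentPolynomial.T i *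
    LaurentPolynomial.C
      (LinearMap.trace S (V.grading i) (V.degAct (DirectSum.decompose 𝒜 h 0) i))

/-- The set of irreducible graded characters `{χ^gr_{M⟨j⟩}}`: graded characters of graded
modules whose underlying ungraded module is simple (the grading of a simple module being
unique up to shift). -/
def IrrGrChars (A : Type u) [CommRing A] (H : Type u) [Ring H] [Algebra A H]
    (𝒜 : ℤ → Submodule A H) [DirectSum.Decomposition 𝒜]
    (S : Type u) [CommRing S] [Algebra A S] : Set (H → LaurentPolynomial S) :=
  { χ | ∃ V : GrMod A H 𝒜 S, V.forget.Simple ∧ χ = V.grChar }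

end Char

section FieldCoeffs

variable {A : Type u} [CommRing A] {H : Type u} [Ring H] [Algebra A H]
  {𝒜 : ℤ → Submodule A H} {F : Type u} [Field F] [Algebra A F]

/-- The characteristic polynomial of the action of a degree-`0` element of `H` on the
degree-`i` piece of a graded module. -/
noncomputable def GrMod.cpoly (V : GrMod A H 𝒜 F) (h : 𝒜 0) (i : ℤ) : Polynomial F :=
  LinearMap.charpoly (V.degAct h i)

/-- `L` is a graded `O ⊗_A H`-lattice in the graded `F ⊗_A H`-module `V`: an `O`-submodule,
stable under `H`, graded, finitely generated and free over `O`, any `O`-basis of which is an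
`F`-basis of `V`. -/
def GrMod.IsLattice (O : ValuationSubring F) (V : GrMod A H 𝒜 F)
    (L : AddSubgroup V.carrier) : Prop :=
  (∀ c : F, c ∈ O → ∀ x ∈ L, c • x ∈ L) ∧
  (∀ h : H, ∀ x ∈ L, h • x ∈ L) ∧
  (∀ x ∈ L, ∀ i : ℤ, ((DirectSum.decompose V.grading x i : V.grading i) : V.carrier) ∈ L) ∧
  ∃ (n : ℕ) (b : Fin n → V.carrier),
    LinearIndependent F b ∧ Submodule.span F (Set.range b) = ⊤ ∧ (∀ m, b m ∈ L) ∧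
    (∀ x ∈ L, ∃ c : Fin n → F, (∀ m, c m ∈ O) ∧ x = ∑ m, c m • b m)

/-- The subgroup `J(O)·L` of a lattice `L`, where `J(O)` is the maximal ideal
(= nonunits) of the valuation ring `O`. -/
def GrMod.mSub (O : ValuationSubring F) (V : GrMod A H 𝒜 F)
    (L : AddSubgroup V.carrier) : AddSubgroup V.carrier :=
  AddSubgroup.closure { z | ∃ c : O, ¬ IsUnit c ∧ ∃ y ∈ L, z = (c : F) • y }

/-- `φ` exhibits the graded `k ⊗_A H`-module `Y` as the modular reduction `k ⊗_O L` of the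
graded `O ⊗_A H`-lattice `L`, along the surjection `π : O → k` onto the residue field. -/
def GrMod.Reduces {k : Type u} [Field k] [Algebra A k]
    (O : ValuationSubring F) (π : O →+* k)
    (V : GrMod A H 𝒜 F) (L : AddSubgroup V.carrier)
    (Y : GrMod A H 𝒜 k) (φ : L →+ Y.carrier) : Prop :=
  Surjective φ ∧
  (∀ x : L, φ x = 0 ↔ (x : V.carrier) ∈ GrMod.mSub O V L) ∧
  (∀ (c : O) (x y : L), (y : V.carrier) = (c : F) • (x : V.carrier) → φ y = π c • φ x) ∧
  (∀ (h : H) (x y : L), (y : V.carrier) = h • (x : V.carrier) → φ y = h • φ x) ∧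
  (∀ (i : ℤ) (x : L), (x : V.carrier) ∈ V.grading i → φ x ∈ Y.grading i) ∧
  (∀ i : ℤ, ∀ y ∈ Y.grading i, ∃ x : L, (x : V.carrier) ∈ V.grading i ∧ φ x = y)

end FieldCoeffs

section Aux

open Polynomial

/-- Multiplicativity of the characteristic polynomial for an invariant subspace. -/
theorem aux_charpoly_sub {F V : Type*} [Field F] [AddCommGroup V] [Module F V]
    [Module.Finite F V] (W : Submodule F V) (e : V →ₗ[F] V) (he : W ≤ W.comap e) :
    e.charpoly = (e.restrict he).charpoly * (W.mapQ W e he).charpoly := by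
  classical
  let m := Module.Free.ChooseBasisIndex F W
  let bW : Module.Basis m F W := Module.Free.chooseBasis F W
  let n := Module.Free.ChooseBasisIndex F (V ⧸ W)
  let bQ : Module.Basis n F (V ⧸ W) := Module.Free.chooseBasis F (V ⧸ W)
  let b := Module.Basis.sumQuot bW bQ
  let A : Matrix m m F := LinearMap.toMatrix bW bW (e.restrict he)
  let B : Matrix m n F := Matrix.of fun i l ↦
    ((Module.Basis.sumQuot bW bQ).repr
      (e ((Module.Basis.sumQuot bW bQ) (Sum.inr l)))) (Sum.inl i)
  let D : Matrix n n F := LinearMap.toMatrix bQ bQ (W.mapQ W e he)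
  suffices LinearMap.toMatrix b b e = Matrix.fromBlocks A B 0 D by
    rw [← LinearMap.charpoly_toMatrix e b, this, ← LinearMap.charpoly_toMatrix _ bW,
      ← LinearMap.charpoly_toMatrix _ bQ, Matrix.charpoly_fromBlocks_zero₂₁]
  ext u v
  cases u with
  | inl i =>
    cases v with
    | inl k =>
      simp only [b, Module.Basis.sumQuot_inl, Matrix.fromBlocks_apply₁₁, A,
        LinearMap.toMatrix_apply]
      apply Module.Basis.sumQuot_repr_inl_of_mem
    | inr l => simp [b, LinearMap.toMatrix_apply, Matrix.fromBlocks_apply₁₂, B]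
  | inr j =>
    cases v with
    | inl k =>
      suffices W.mkQ (e (bW k)) = 0 by simp [LinearMap.toMatrix_apply, b, this]
      rw [← LinearMap.mem_ker, Submodule.ker_mkQ]
      exact he (Submodule.coe_mem (bW k))
    | inr l =>
      simp only [LinearMap.toMatrix_apply, Module.Basis.sumQuot_repr_inr,
        Matrix.fromBlocks_apply₂₂, b, D]
      rw [← Module.Basis.sumQuot_inr bW bQ l, W.mapQ_apply]
      simp

/-- Multiplicativity of the characteristic polynomial in short exact sequences. -/
theorem aux_charpoly_ses {F X Y Z : Type*} [Field F] [AddCommGroup X] [Module F X]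
    [Module.Finite F X] [AddCommGroup Y] [Module F Y] [Module.Finite F Y]
    [AddCommGroup Z] [Module F Z] [Module.Finite F Z]
    (f : X →ₗ[F] Y) (g : Y →ₗ[F] Z) (hf : Injective f) (hg : Surjective g)
    (hfg : ∀ y, g y = 0 ↔ ∃ x, f x = y)
    (a : X →ₗ[F] X) (b : Y →ₗ[F] Y) (c : Z →ₗ[F] Z)
    (hab : ∀ x, f (a x) = b (f x)) (hbc : ∀ y, g (b y) = c (g y)) :
    b.charpoly = a.charpoly * c.charpoly := by
  have hk : LinearMap.ker g = LinearMap.range f := by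
    ext y; simp [hfg]
  let W := LinearMap.ker g
  have he : W ≤ W.comap b := by
    intro y hy
    simp only [W, Submodule.mem_comap, LinearMap.mem_ker] at hy ⊢
    rw [hbc, hy, map_zero]
  rw [aux_charpoly_sub W b he]
  let e1 : X ≃ₗ[F] W := (LinearEquiv.ofInjective f hf).trans (LinearEquiv.ofEq _ _ hk.symm)
  have he1 : ∀ x, (e1 x : Y) = f x := fun x => rfl
  let e2 : (Y ⧸ W) ≃ₗ[F] Z := g.quotKerEquivOfSurjective hg
  have he2 : ∀ y, e2 (Submodule.Quotient.mk y) = g y := fun y => rfl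
  congr 1
  · rw [← LinearEquiv.charpoly_conj e1 a]
    congr 1
    ext w
    obtain ⟨x, rfl⟩ := e1.surjective w
    simp [LinearEquiv.conj_apply, he1, hab]
  · rw [← LinearEquiv.charpoly_conj e2 (W.mapQ W b he)]
    congr 1
    ext z
    obtain ⟨q, rfl⟩ := e2.surjective z
    obtain ⟨y, rfl⟩ := Submodule.Quotient.mk_surjective _ q
    simp only [LinearEquiv.conj_apply, LinearMap.comp_apply, LinearEquiv.coe_coe,
      LinearEquiv.symm_apply_apply, Submodule.mapQ_apply]
    rw [he2, he2, hbc]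

/-- Coefficients of the characteristic polynomial of an integral endomorphism are integral. -/
theorem aux_charpoly_integral {A K V : Type*} [CommRing A] [Field K] [Algebra A K]
    [AddCommGroup V] [Module K V] [Module.Finite K V] (f : V →ₗ[K] V)
    (p : A[X]) (hp : p.Monic) (hpf : aeval (R := K) f (p.map (algebraMap A K)) = 0) (m : ℕ) :
    IsIntegral A (f.charpoly.coeff m) := by
  classical
  let E := AlgebraicClosure K
  let b := Module.Free.chooseBasis K V
  let M := LinearMap.toMatrix b b f
  have hM : aeval M (p.map (algebraMap A K)) = 0 := by
    have : M = LinearMap.toMatrixAlgEquiv b f := rfl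
    rw [this, aeval_algHom_apply, hpf, map_zero]
  let N := M.map (algebraMap K E)
  have hN : aeval N (p.map (algebraMap A E)) = 0 := by
    have : N = (Algebra.ofId K E).mapMatrix M := rfl
    rw [IsScalarTower.algebraMap_eq A K E, ← Polynomial.map_map, aeval_map_algebraMap, this,
      aeval_algHom_apply, hM, map_zero]
  have hc : f.charpoly.map (algebraMap K E) = N.charpoly := by
    rw [← LinearMap.charpoly_toMatrix f b, Matrix.charpoly_map]
  have key : IsIntegral A (N.charpoly.coeff m) := by
    apply isIntegral_coeff_of_factors
    · rw [(Matrix.charpoly_monic N).leadingCoeff]; exact isIntegral_one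
    · exact IsAlgClosed.splits _
    · intro x hx
      rw [← Matrix.mem_spectrum_iff_isRoot_charpoly] at hx
      refine ⟨p, hp, ?_⟩
      have h1 := spectrum.subset_polynomial_aeval N (p.map (algebraMap A E)) ⟨x, hx, rfl⟩
      rw [hN] at h1
      rcases isEmpty_or_nonempty (Module.Free.ChooseBasisIndex K V) with h | h
      · exact absurd h1 (by simp [spectrum.of_subsingleton])
      · rw [spectrum.zero_eq] at h1
        simpa [eval_map] using h1
  rw [← hc, coeff_map] at key
  exact (isIntegral_algHom_iff (IsScalarTower.toAlgHom A K E) (algebraMap K E).injective).1 key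

/-- A criterion for a family of submodules to give a direct sum decomposition. -/
theorem aux_isInternal {F M : Type*} [Field F] [AddCommGroup M] [Module F M]
    (ℳ : ℤ → Submodule F M) (pr : ℤ → M →ₗ[F] M) (hmem : ∀ i x, pr i x ∈ ℳ i)
    (hself : ∀ i x, x ∈ ℳ i → pr i x = x) (hne : ∀ i j x, i ≠ j → x ∈ ℳ i → pr j x = 0)
    (hsum : ∀ x, ∃ s : Finset ℤ, x = ∑ i ∈ s, pr i x) : DirectSum.IsInternal ℳ := by
  classical
  have key : ∀ (z : ⨁ i, ℳ i) (j : ℤ),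
      pr j (DirectSum.coeAddMonoidHom ℳ z) = (z j : M) := by
    intro z j
    induction z using DirectSum.induction_on with
    | zero => simp
    | of i x =>
      rw [DirectSum.coeAddMonoidHom_of]
      by_cases h : i = j
      · subst h
        simp [hself _ _ x.2]
      · rw [hne i j x h x.2, DirectSum.of_eq_of_ne _ _ _ (Ne.symm h)]; simp
    | add a b ha hb => simp [ha, hb]
  constructor
  · rw [injective_iff_map_eq_zero]
    intro z hz
    ext j
    rw [← key z j, hz]; simp
  · intro x
    obtain ⟨s, hs⟩ := hsum x
    refine ⟨∑ i ∈ s, DirectSum.of (fun i => ℳ i) i ⟨pr i x, hmem i x⟩, ?_⟩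
    rw [map_sum]
    conv_rhs => rw [hs]
    exact Finset.sum_congr rfl fun i _ => DirectSum.coeAddMonoidHom_of ℳ i _

end Aux

section GrAux

variable {A : Type u} [CommRing A] {H : Type u} [Ring H] [Algebra A H]
  {𝒜 : ℤ → Submodule A H} {F : Type u} [Field F] [Algebra A F]

namespace GrMod

/-- Projection to the degree-`i` piece. -/
noncomputable def pr (V : GrMod A H 𝒜 F) (i : ℤ) : V.carrier →ₗ[F] V.carrier where
  toFun x := (DirectSum.decompose V.grading x i : V.grading i)
  map_add' x y := by simp
  map_smul' s x := by
    rw [DirectSum.decompose_smul]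
    rfl

theorem pr_mem (V : GrMod A H 𝒜 F) (i : ℤ) (x : V.carrier) : V.pr i x ∈ V.grading i :=
  (DirectSum.decompose V.grading x i).2

theorem pr_self (V : GrMod A H 𝒜 F) (i : ℤ) (x : V.carrier) (hx : x ∈ V.grading i) :
    V.pr i x = x := DirectSum.decompose_of_mem_same _ hx

theorem pr_ne (V : GrMod A H 𝒜 F) (i j : ℤ) (x : V.carrier) (hij : i ≠ j)
    (hx : x ∈ V.grading i) : V.pr j x = 0 := DirectSum.decompose_of_mem_ne _ hx hij

theorem pr_sum (V : GrMod A H 𝒜 F) (x : V.carrier) :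
    ∃ s : Finset ℤ, x = ∑ i ∈ s, V.pr i x := by
  classical
  exact ⟨_, (DirectSum.sum_support_decompose V.grading x).symm⟩

theorem pr_ext (V : GrMod A H 𝒜 F) (x y : V.carrier) (h : ∀ i, V.pr i x = V.pr i y) :
    x = y := by
  apply (DirectSum.decompose V.grading).injective
  ext i
  exact h i

theorem mem_of_pr (V : GrMod A H 𝒜 F) (x : V.carrier) (i : ℤ)
    (h : ∀ j, i ≠ j → V.pr j x = 0) : x ∈ V.grading i := by
  have : x = V.pr i x := by
    apply V.pr_ext
    intro j
    by_cases hj : i = j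
    · subst hj
      rw [V.pr_self _ _ (V.pr_mem i x)]
    · rw [h j hj, V.pr_ne i j _ hj (V.pr_mem i x)]
  rw [this]
  exact V.pr_mem i x

/-- Degree zero elements commute with a graded additive map. -/
theorem pr_map (V W : GrMod A H 𝒜 F) (f : V.carrier →+ W.carrier)
    (hf : ∀ (i : ℤ), ∀ x ∈ V.grading i, f x ∈ W.grading i) (i : ℤ) (x : V.carrier) :
    W.pr i (f x) = f (V.pr i x) := by
  classical
  obtain ⟨s, hs⟩ := V.pr_sum x
  suffices ∀ s : Finset ℤ, W.pr i (f (∑ j ∈ s, V.pr j x)) = f (V.pr i (∑ j ∈ s, V.pr j x)) by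
    rw [hs]; exact this s
  intro s
  simp only [map_sum]
  apply Finset.sum_congr rfl
  intro j _
  by_cases hj : j = i
  · subst hj
    rw [W.pr_self _ _ (hf _ _ (V.pr_mem _ _)), V.pr_self _ _ (V.pr_mem _ _)]
  · rw [W.pr_ne j i _ hj (hf _ _ (V.pr_mem _ _)), V.pr_ne j i _ hj (V.pr_mem _ _), map_zero]

theorem pr_smulH [GradedAlgebra 𝒜] (V : GrMod A H 𝒜 F) (h : H) (i j : ℤ) (x : V.carrier)
    (hx : x ∈ V.grading i) :
    V.pr j (h • x) = (DirectSum.decompose 𝒜 h (j - i) : H) • x := by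
  classical
  induction h using DirectSum.Decomposition.inductionOn 𝒜 with
  | zero => simp
  | @homogeneous k m =>
    have h1 := V.grading_smul k i m m.2 x hx
    by_cases hk : k = j - i
    · subst hk
      rw [DirectSum.decompose_of_mem_same _ m.2]
      exact V.pr_self _ _ (by simpa using h1)
    · rw [DirectSum.decompose_of_mem_ne _ m.2 hk, zero_smul]
      exact V.pr_ne _ _ _ (by omega) h1
  | add a b ha hb => simp [add_smul, ha, hb]

/-- The action of `H` on a homogeneous component commutes suitably with projections. -/
theorem actL_apply (V : GrMod A H 𝒜 F) (h : H) (x : V.carrier) :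
    V.forget.act h x = h • x := rfl

/-- A graded submodule as a graded module. -/
noncomputable def sub (V : GrMod A H 𝒜 F) (p : Submodule F V.carrier)
    (hH : ∀ (h : H), ∀ x ∈ p, h • x ∈ p) (hg : ∀ x ∈ p, ∀ i, V.pr i x ∈ p) :
    GrMod A H 𝒜 F :=
  letI : Module H p :=
    { smul := fun h x => ⟨h • (x : V.carrier), hH h x x.2⟩
      one_smul := fun x => Subtype.ext (one_smul H (x : V.carrier))
      mul_smul := fun a b x => Subtype.ext (mul_smul a b (x : V.carrier))
      smul_zero := fun a => Subtype.ext (smul_zero a)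
      smul_add := fun a x y => Subtype.ext (smul_add a (x : V.carrier) (y : V.carrier))
      add_smul := fun a b x => Subtype.ext (add_smul a b (x : V.carrier))
      zero_smul := fun x => Subtype.ext (zero_smul H (x : V.carrier)) }
  { carrier := p
    smul_comm' := fun h s x => Subtype.ext (V.smul_comm' h s x)
    compat := fun a x => Subtype.ext (V.compat a x)
    grading := fun i => (V.grading i).comap p.subtype
    decomp := (aux_isInternal (fun i => (V.grading i).comap p.subtype)
      (fun i => (V.pr i).restrict (fun x hx => hg x hx i))
      (fun i x => V.pr_mem i x)
      (fun i x hx => Subtype.ext (V.pr_self i x hx))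
      (fun i j x hij hx => Subtype.ext (V.pr_ne i j x hij hx))
      (fun x => by
        obtain ⟨s, hs⟩ := V.pr_sum (x : V.carrier)
        refine ⟨s, Subtype.ext ?_⟩
        rw [AddSubmonoidClass.coe_finsetSum]
        exact hs)).chooseDecomposition
    grading_smul := fun i j h hh x hx => V.grading_smul i j h hh x hx }

/-- A quotient by a graded submodule as a graded module. -/
noncomputable def quot (V : GrMod A H 𝒜 F) (p : Submodule F V.carrier)
    (hH : ∀ (h : H), ∀ x ∈ p, h • x ∈ p) (hg : ∀ x ∈ p, ∀ i, V.pr i x ∈ p) :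
    GrMod A H 𝒜 F :=
  letI : Module H (V.carrier ⧸ p) :=
    { smul := fun h => p.mapQ p (V.forget.act h) (fun x hx => hH h x hx)
      one_smul := fun x => by
        obtain ⟨x, rfl⟩ := Submodule.Quotient.mk_surjective _ x
        exact congrArg Submodule.Quotient.mk (one_smul H x)
      mul_smul := fun a b x => by
        obtain ⟨x, rfl⟩ := Submodule.Quotient.mk_surjective _ x
        exact congrArg Submodule.Quotient.mk (mul_smul a b x)
      smul_zero := fun a => map_zero (p.mapQ p (V.forget.act a) (fun x hx => hH a x hx))
      smul_add := fun a => map_add (p.mapQ p (V.forget.act a) (fun x hx => hH a x hx))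
      add_smul := fun a b x => by
        obtain ⟨x, rfl⟩ := Submodule.Quotient.mk_surjective _ x
        exact congrArg Submodule.Quotient.mk (add_smul a b x)
      zero_smul := fun x => by
        obtain ⟨x, rfl⟩ := Submodule.Quotient.mk_surjective _ x
        exact congrArg Submodule.Quotient.mk (zero_smul H x) }
  { carrier := V.carrier ⧸ p
    smul_comm' := fun h s x => by
      obtain ⟨x, rfl⟩ := Submodule.Quotient.mk_surjective _ x
      exact congrArg Submodule.Quotient.mk (V.smul_comm' h s x)
    compat := fun a x => by
      obtain ⟨x, rfl⟩ := Submodule.Quotient.mk_surjective _ x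
      exact congrArg Submodule.Quotient.mk (V.compat a x)
    grading := fun i => (V.grading i).map p.mkQ
    decomp := (aux_isInternal (fun i => (V.grading i).map p.mkQ)
      (fun i => p.mapQ p (V.pr i) (fun x hx => hg x hx i))
      (fun i x => by
        obtain ⟨x, rfl⟩ := Submodule.Quotient.mk_surjective _ x
        exact ⟨V.pr i x, V.pr_mem i x, rfl⟩)
      (fun i x hx => by
        obtain ⟨x, hx, rfl⟩ := hx
        exact congrArg Submodule.Quotient.mk (V.pr_self i x hx))
      (fun i j x hij hx => by
        obtain ⟨x, hx, rfl⟩ := hx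
        exact congrArg Submodule.Quotient.mk (V.pr_ne i j x hij hx))
      (fun x => by
        obtain ⟨x, rfl⟩ := Submodule.Quotient.mk_surjective _ x
        obtain ⟨s, hs⟩ := V.pr_sum x
        refine ⟨s, ?_⟩
        have h2 := congrArg p.mkQ hs
        rw [map_sum] at h2
        exact h2)).chooseDecomposition
    grading_smul := fun i j h hh x hx => by
      obtain ⟨x, hx, rfl⟩ := hx
      exact ⟨h • x, V.grading_smul i j h hh x hx, rfl⟩ }

/-- The tautological short exact sequence. -/
noncomputable def subQuotSES (V : GrMod A H 𝒜 F) (p : Submodule F V.carrier)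
    (hH : ∀ (h : H), ∀ x ∈ p, h • x ∈ p) (hg : ∀ x ∈ p, ∀ i, V.pr i x ∈ p) :
    GrSES (V.sub p hH hg) V (V.quot p hH hg) where
  f := p.subtype.toAddMonoidHom
  g := p.mkQ.toAddMonoidHom
  f_smulS _ _ := rfl
  f_smulH _ _ := rfl
  g_smulS _ _ := rfl
  g_smulH _ _ := rfl
  inj := Subtype.val_injective
  surj := Submodule.mkQ_surjective p
  exact y := by
    constructor
    · intro hy
      exact ⟨⟨y, (Submodule.Quotient.mk_eq_zero p).1 hy⟩, rfl⟩
    · rintro ⟨x, rfl⟩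
      exact (Submodule.Quotient.mk_eq_zero p).2 x.2
  f_graded i x hx := hx
  g_graded i y hy := ⟨y, hy, rfl⟩

/-- The zero graded module. -/
noncomputable def zeroMod : GrMod A H 𝒜 F where
  carrier := PUnit
  modH := { smul := fun _ x => x
            one_smul := fun _ => rfl
            mul_smul := fun _ _ _ => rfl
            smul_zero := fun _ => rfl
            smul_add := fun _ _ _ => rfl
            add_smul := fun _ _ _ => rfl
            zero_smul := fun _ => rfl }
  smul_comm' _ _ _ := rfl
  compat _ _ := rfl
  grading := fun _ => ⊥
  decomp := (aux_isInternal (F := F) (M := PUnit.{u+1}) (fun _ => ⊥) (fun _ => 0)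
    (fun _ _ => by simp) (fun _ _ _ => rfl) (fun _ _ _ _ _ => rfl)
    (fun _ => ⟨∅, rfl⟩)).chooseDecomposition
  grading_smul _ _ _ _ _ _ := rfl

theorem cls_ses {X Y Z : GrMod A H 𝒜 F} (e : GrSES X Y Z) : Y.cls = X.cls + Z.cls := by
  have h : (QuotientAddGroup.mk (FreeAbelianGroup.of Y - FreeAbelianGroup.of X -
      FreeAbelianGroup.of Z) : FreeAbelianGroup (GrMod A H 𝒜 F) ⧸
        AddSubgroup.closure (grRelSet A H 𝒜 F)) = 0 := by
    rw [QuotientAddGroup.eq_zero_iff]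
    exact AddSubgroup.subset_closure ⟨X, Y, Z, ⟨e⟩, rfl⟩
  have h2 : Y.cls - X.cls - Z.cls = 0 := h
  rw [sub_sub, sub_eq_zero] at h2
  exact h2

theorem cpoly_ses {X Y Z : GrMod A H 𝒜 F} (e : GrSES X Y Z) (h : 𝒜 0) (i : ℤ) :
    Y.cpoly h i = X.cpoly h i * Z.cpoly h i := by
  let f : X.grading i →ₗ[F] Y.grading i :=
    { toFun := fun x => ⟨e.f x, e.f_graded i x x.2⟩
      map_add' := fun x y => Subtype.ext (map_add e.f (x : X.carrier) (y : X.carrier))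
      map_smul' := fun s x => Subtype.ext (e.f_smulS s x) }
  let g : Y.grading i →ₗ[F] Z.grading i :=
    { toFun := fun x => ⟨e.g x, e.g_graded i x x.2⟩
      map_add' := fun x y => Subtype.ext (map_add e.g (x : Y.carrier) (y : Y.carrier))
      map_smul' := fun s x => Subtype.ext (e.g_smulS s x) }
  refine aux_charpoly_ses f g ?_ ?_ ?_ _ _ _ ?_ ?_
  · intro x y hxy
    exact Subtype.ext (e.inj (congrArg Subtype.val hxy))
  · intro z
    obtain ⟨y, hy⟩ := e.surj z
    refine ⟨⟨Y.pr i y, Y.pr_mem i y⟩, Subtype.ext ?_⟩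
    change e.g (Y.pr i y) = z
    rw [← Y.pr_map Z e.g e.g_graded, hy, Z.pr_self _ _ z.2]
  · intro y
    constructor
    · intro hy
      obtain ⟨x, hx⟩ := (e.exact y).1 (congrArg Subtype.val hy)
      refine ⟨⟨X.pr i x, X.pr_mem i x⟩, Subtype.ext ?_⟩
      change e.f (X.pr i x) = y
      rw [← X.pr_map Y e.f e.f_graded, hx, Y.pr_self _ _ y.2]
    · rintro ⟨x, rfl⟩
      exact Subtype.ext ((e.exact _).2 ⟨x, rfl⟩)
  · intro x
    exact Subtype.ext (e.f_smulH h x)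
  · intro x
    exact Subtype.ext (e.g_smulH h x)

/-- A trivial module fits in `0 → V → V → V → 0`. -/
def sesOfSubsingleton (V : GrMod A H 𝒜 F) (hV : ∀ x : V.carrier, x = 0) : GrSES V V V where
  f := AddMonoidHom.id _
  g := AddMonoidHom.id _
  f_smulS _ _ := rfl
  f_smulH _ _ := rfl
  g_smulS _ _ := rfl
  g_smulH _ _ := rfl
  inj _ _ h := h
  surj x := ⟨x, rfl⟩
  exact y := ⟨fun _ => ⟨y, rfl⟩, fun _ => hV y⟩
  f_graded _ _ h := h
  g_graded _ _ h := h

theorem cls_zero (V : GrMod A H 𝒜 F) (hV : ∀ x : V.carrier, x = 0) : V.cls = 0 := by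
  have := cls_ses (V.sesOfSubsingleton hV)
  simpa using this

theorem cpoly_zero (V : GrMod A H 𝒜 F) (hV : ∀ x : V.carrier, x = 0) (h : 𝒜 0) (i : ℤ) :
    V.cpoly h i = 1 := by
  have h1 := cpoly_ses (V.sesOfSubsingleton hV) h i
  have h2 : V.cpoly h i ≠ 0 := (LinearMap.charpoly_monic _).ne_zero
  exact (mul_eq_left₀ h2).1 h1.symm

/-- A graded isomorphism gives a short exact sequence with zero quotient. -/
theorem ses_of_iso {V W : GrMod A H 𝒜 F} (e : V.GrIso W) :
    Nonempty (GrSES V W (zeroMod : GrMod A H 𝒜 F)) := by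
  obtain ⟨e, h1, h2, h3⟩ := e
  exact ⟨{
    f := e.toAddMonoidHom
    g := 0
    f_smulS := h1
    f_smulH := h2
    g_smulS := fun _ _ => rfl
    g_smulH := fun _ _ => rfl
    inj := e.injective
    surj := fun _ => ⟨0, rfl⟩
    exact := fun y => ⟨fun _ => e.surjective y, fun _ => rfl⟩
    f_graded := h3
    g_graded := fun _ _ _ => rfl }⟩

theorem cls_iso {V W : GrMod A H 𝒜 F} (e : V.GrIso W) : W.cls = V.cls := by
  obtain ⟨e⟩ := ses_of_iso e
  rw [cls_ses e, cls_zero zeroMod (fun _ => rfl), add_zero]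

theorem cpoly_iso {V W : GrMod A H 𝒜 F} (e : V.GrIso W) (h : 𝒜 0) (i : ℤ) :
    W.cpoly h i = V.cpoly h i := by
  obtain ⟨e⟩ := ses_of_iso e
  rw [cpoly_ses e, cpoly_zero zeroMod (fun _ => rfl), mul_one]

/-- Existence of composition factors, at the level of classes and characteristic polynomials. -/
theorem exists_factors (n : ℕ) : ∀ V : GrMod A H 𝒜 F, Module.finrank F V.carrier = n →
    ∃ s : Multiset (GrMod A H 𝒜 F), (∀ S ∈ s, S.GrSimple) ∧ V.cls = (s.map cls).sum ∧
      ∀ (h : 𝒜 0) (i : ℤ), V.cpoly h i = (s.map fun S => S.cpoly h i).prod := by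
  induction n using Nat.strong_induction_on with
  | _ n ih =>
    intro V hn
    by_cases h0 : ∀ x : V.carrier, x = 0
    · exact ⟨0, by simp, by simp [cls_zero V h0], fun h i => by simp [cpoly_zero V h0]⟩
    by_cases hs : V.GrSimple
    · exact ⟨{V}, by simpa using hs, by simp, fun h i => by simp⟩
    push Not at h0
    obtain ⟨x, hx⟩ := h0
    have : ∃ p : AddSubgroup V.carrier, V.IsGrSub p ∧ p ≠ ⊥ ∧ p ≠ ⊤ := by
      by_contra hcon
      apply hs
      refine ⟨⟨x, 0, hx⟩, fun p hp => ?_⟩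
      by_contra h2
      exact hcon ⟨p, hp, not_or.1 h2⟩
    obtain ⟨p, ⟨⟨hpS, hpH⟩, hpg⟩, hb, ht⟩ := this
    let P : Submodule F V.carrier := { p with smul_mem' := fun s x hx => hpS s x hx }
    have hPb : P ≠ ⊥ := by
      intro h
      apply hb
      rw [eq_bot_iff]
      intro y hy
      have : y ∈ P := hy
      rw [h] at this
      exact this
    have hPt : P ≠ ⊤ := by
      intro h
      apply ht
      rw [eq_top_iff]
      intro y _
      have : y ∈ P := by rw [h]; trivial
      exact this
    let e := V.subQuotSES P hpH hpg
    have d1 : Module.finrank F (V.sub P hpH hpg).carrier < n := by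
      rw [← hn]
      exact Submodule.finrank_lt hPt
    have d2 : Module.finrank F (V.quot P hpH hpg).carrier < n := by
      rw [← hn]
      have h1 : Module.finrank F (V.carrier ⧸ P) + Module.finrank F P =
        Module.finrank F V.carrier := Submodule.finrank_quotient_add_finrank P
      have h2 : 0 < Module.finrank F P := by
        rw [Nat.pos_iff_ne_zero, Ne, Submodule.finrank_eq_zero]
        exact hPb
      change Module.finrank F (V.carrier ⧸ P) < _
      omega
    obtain ⟨s1, a1, b1, c1⟩ := ih _ d1 _ rfl
    obtain ⟨s2, a2, b2, c2⟩ := ih _ d2 _ rfl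
    refine ⟨s1 + s2, ?_, ?_, ?_⟩
    · intro S hS
      rcases Multiset.mem_add.1 hS with h | h
      · exact a1 S h
      · exact a2 S h
    · rw [cls_ses e, b1, b2, Multiset.map_add, Multiset.sum_add]
    · intro h i
      rw [cpoly_ses e, c1, c2, Multiset.map_add, Multiset.prod_add]

end GrMod

end GrAux

section GrAux2

variable {A : Type u} [CommRing A] {H : Type u} [Ring H] [Algebra A H]
  {𝒜 : ℤ → Submodule A H} [GradedAlgebra 𝒜] {F : Type u} [Field F] [Algebra A F]

namespace GrMod

/-- The `F ⊗ H`-submodule of `S × T` generated by `(x, y)`. -/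
def gen (hF : ∀ x : F, ∃ a b : A, algebraMap A F b ≠ 0 ∧ x * algebraMap A F b = algebraMap A F a)
    (S T : GrMod A H 𝒜 F) (x : S.carrier) (y : T.carrier) :
    AddSubgroup (S.carrier × T.carrier) where
  carrier := { z | ∃ (c : F) (h : H), z = (c • h • x, c • h • y) }
  zero_mem' := ⟨0, 0, by simp only [zero_smul]; rfl⟩
  neg_mem' := by
    rintro _ ⟨c, h, rfl⟩
    exact ⟨-c, h, by simp⟩
  add_mem' := by
    rintro _ _ ⟨c, h, rfl⟩ ⟨c', h', rfl⟩
    obtain ⟨a, b, hb, hab⟩ := hF c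
    obtain ⟨a', b', hb', hab'⟩ := hF c'
    have e1 : (algebraMap A F b * algebraMap A F b')⁻¹ *
        (algebraMap A F a * algebraMap A F b') = c := by
      rw [← hab]; field_simp
    have e2 : (algebraMap A F b * algebraMap A F b')⁻¹ *
        (algebraMap A F a' * algebraMap A F b) = c' := by
      rw [← hab']; field_simp
    refine ⟨(algebraMap A F b * algebraMap A F b')⁻¹,
      algebraMap A H (a * b') * h + algebraMap A H (a' * b) * h', ?_⟩
    have key : ∀ (V : GrMod A H 𝒜 F) (v : V.carrier),
        (algebraMap A F b * algebraMap A F b')⁻¹ •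
          (algebraMap A H (a * b') * h + algebraMap A H (a' * b) * h') • v =
        c • h • v + c' • h' • v := by
      intro V v
      rw [add_smul, mul_smul, mul_smul, V.compat, V.compat, smul_add, smul_smul, smul_smul,
        map_mul, map_mul, e1, e2]
    rw [key, key]
    rfl

theorem exists_sep
    (hF : ∀ x : F, ∃ a b : A, algebraMap A F b ≠ 0 ∧ x * algebraMap A F b = algebraMap A F a)
    (S T : GrMod A H 𝒜 F) (hS : S.GrSimple) (hT : T.GrSimple) (hST : ¬ S.GrIso T)
    (i : ℤ) (x : S.carrier) (hx : x ∈ S.grading i) (hx0 : x ≠ 0)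
    (y : T.carrier) (hy : y ∈ T.grading i) :
    ∃ (c : F) (h : H), h ∈ 𝒜 0 ∧ c • h • x = x ∧ h • y = 0 := by
  let G := gen hF S T x y
  have hGS : ∀ (c : F) (z : S.carrier × T.carrier), z ∈ G → (c • z.1, c • z.2) ∈ G := by
    rintro c _ ⟨d, h, rfl⟩
    exact ⟨c * d, h, by simp [mul_smul]⟩
  have hGH : ∀ (k : H) (z : S.carrier × T.carrier), z ∈ G → (k • z.1, k • z.2) ∈ G := by
    rintro k _ ⟨d, h, rfl⟩
    exact ⟨d, k * h, by simp [mul_smul, S.smul_comm', T.smul_comm']⟩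
  have hGg : ∀ (j : ℤ) (z : S.carrier × T.carrier), z ∈ G →
      (S.pr j z.1, T.pr j z.2) ∈ G := by
    rintro j _ ⟨d, h, rfl⟩
    refine ⟨d, (DirectSum.decompose 𝒜 h (j - i) : H), ?_⟩
    simp only [map_smul]
    rw [S.pr_smulH h i j x hx, T.pr_smulH h i j y hy]
  have hxy : (x, y) ∈ G := ⟨1, 1, by simp⟩
  -- it is enough to find `(x, 0)` in `G`
  have main : (x, (0 : T.carrier)) ∈ G →
      ∃ (c : F) (h : H), h ∈ 𝒜 0 ∧ c • h • x = x ∧ h • y = 0 := by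
    rintro ⟨c, h, hch⟩
    have h1 : x = c • h • x := congrArg Prod.fst hch
    have h2 : 0 = c • h • y := congrArg Prod.snd hch
    have hc : c ≠ 0 := by
      rintro rfl
      exact hx0 (by simpa using h1)
    refine ⟨c, (DirectSum.decompose 𝒜 h 0 : H), (DirectSum.decompose 𝒜 h 0).2, ?_, ?_⟩
    · have := congrArg (S.pr i) h1
      rw [map_smul, S.pr_smulH h i i x hx, S.pr_self _ _ hx, sub_self] at this
      exact this.symm
    · have h3 : h • y = 0 := (smul_eq_zero.1 h2.symm).resolve_left hc
      have := congrArg (T.pr i) h3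
      rw [T.pr_smulH h i i y hy, map_zero, sub_self] at this
      exact this
  let KT : AddSubgroup T.carrier := G.comap (AddMonoidHom.inr S.carrier T.carrier)
  let KS : AddSubgroup S.carrier := G.comap (AddMonoidHom.inl S.carrier T.carrier)
  let PS : AddSubgroup S.carrier := G.map (AddMonoidHom.fst S.carrier T.carrier)
  let PT : AddSubgroup T.carrier := G.map (AddMonoidHom.snd S.carrier T.carrier)
  have hKT : T.IsGrSub KT := by
    refine ⟨⟨?_, ?_⟩, ?_⟩
    · have aux : ∀ (s : F) (z : T.carrier), ((0 : S.carrier), z) ∈ G → ((0 : S.carrier), s • z) ∈ G := by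
        intro s z hz
        have := hGS s _ hz
        simp only [smul_zero] at this
        exact this
      exact fun s z hz => aux s z hz
    · have aux : ∀ (s : H) (z : T.carrier), ((0 : S.carrier), z) ∈ G → ((0 : S.carrier), s • z) ∈ G := by
        intro s z hz
        have := hGH s _ hz
        simp only [smul_zero] at this
        exact this
      exact fun s z hz => aux s z hz
    · intro z hz j
      have := hGg j _ hz
      simp only [AddMonoidHom.inr_apply, map_zero] at this
      exact this
  have hKS : S.IsGrSub KS := by
    refine ⟨⟨?_, ?_⟩, ?_⟩
    · have aux : ∀ (s : F) (z : S.carrier), (z, (0 : T.carrier)) ∈ G → (s • z, (0 : T.carrier)) ∈ G := by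
        intro s z hz
        have := hGS s _ hz
        simp only [smul_zero] at this
        exact this
      exact fun s z hz => aux s z hz
    · have aux : ∀ (s : H) (z : S.carrier), (z, (0 : T.carrier)) ∈ G → (s • z, (0 : T.carrier)) ∈ G := by
        intro s z hz
        have := hGH s _ hz
        simp only [smul_zero] at this
        exact this
      exact fun s z hz => aux s z hz
    · intro z hz j
      have := hGg j _ hz
      simp only [AddMonoidHom.inl_apply, map_zero] at this
      exact this
  have hPS : S.IsGrSub PS := by
    refine ⟨⟨?_, ?_⟩, ?_⟩
    · rintro s _ ⟨z, hz, rfl⟩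
      exact ⟨_, hGS s _ hz, rfl⟩
    · rintro s _ ⟨z, hz, rfl⟩
      exact ⟨_, hGH s _ hz, rfl⟩
    · rintro _ ⟨z, hz, rfl⟩ j
      exact ⟨_, hGg j _ hz, rfl⟩
  have hPT : T.IsGrSub PT := by
    refine ⟨⟨?_, ?_⟩, ?_⟩
    · rintro s _ ⟨z, hz, rfl⟩
      exact ⟨_, hGS s _ hz, rfl⟩
    · rintro s _ ⟨z, hz, rfl⟩
      exact ⟨_, hGH s _ hz, rfl⟩
    · rintro _ ⟨z, hz, rfl⟩ j
      exact ⟨_, hGg j _ hz, rfl⟩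
  rcases hT.2 KT hKT with hKTb | hKTt
  swap
  · apply main
    have h1 : y ∈ KT := by rw [hKTt]; trivial
    have h2 : ((0 : S.carrier), y) ∈ G := h1
    simpa using G.sub_mem hxy h2
  rcases hS.2 KS hKS with hKSb | hKSt
  swap
  · apply main
    have h1 : x ∈ KS := by rw [hKSt]; trivial
    exact h1
  have hPSt : PS = ⊤ := by
    refine (hS.2 PS hPS).resolve_left fun h => hx0 ?_
    have h1 : x ∈ PS := ⟨_, hxy, rfl⟩
    rw [h] at h1
    exact h1
  rcases hT.2 PT hPT with hPTb | hPTt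
  · apply main
    have h1 : y ∈ PT := ⟨_, hxy, rfl⟩
    rw [hPTb] at h1
    have h2 : y = 0 := h1
    rw [h2] at hxy
    exact hxy
  exfalso
  apply hST
  let f1 : G →+ S.carrier := (AddMonoidHom.fst S.carrier T.carrier).comp G.subtype
  let f2 : G →+ T.carrier := (AddMonoidHom.snd S.carrier T.carrier).comp G.subtype
  have hzT : ∀ t : T.carrier, ((0 : S.carrier), t) ∈ G → t = 0 := by
    intro t ht
    have h1 : t ∈ KT := ht
    rw [hKTb] at h1
    exact h1
  have hzS : ∀ s : S.carrier, (s, (0 : T.carrier)) ∈ G → s = 0 := by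
    intro t ht
    have h1 : t ∈ KS := ht
    rw [hKSb] at h1
    exact h1
  have b1 : Bijective f1 := by
    constructor
    · rw [injective_iff_map_eq_zero]
      rintro ⟨⟨s, t⟩, hst⟩ h0
      have h0 : s = 0 := h0
      subst h0
      have := hzT t hst
      subst this
      rfl
    · intro s
      have h1 : s ∈ PS := by rw [hPSt]; trivial
      obtain ⟨z, hz, rfl⟩ := h1
      exact ⟨⟨z, hz⟩, rfl⟩
  have b2 : Bijective f2 := by
    constructor
    · rw [injective_iff_map_eq_zero]
      rintro ⟨⟨s, t⟩, hst⟩ h0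
      have h0 : t = 0 := h0
      subst h0
      have := hzS s hst
      subst this
      rfl
    · intro s
      have h1 : s ∈ PT := by rw [hPTt]; trivial
      obtain ⟨z, hz, rfl⟩ := h1
      exact ⟨⟨z, hz⟩, rfl⟩
  let e1 := AddEquiv.ofBijective f1 b1
  let e2 := AddEquiv.ofBijective f2 b2
  let e := e1.symm.trans e2
  have hmem : ∀ s, (s, e s) ∈ G := by
    intro s
    obtain ⟨g, rfl⟩ := e1.surjective s
    have : e (e1 g) = e2 g := by simp [e]
    rw [this]
    exact g.2
  have huniq : ∀ s t, (s, t) ∈ G → e s = t := by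
    intro s t hst
    have := G.sub_mem (hmem s) hst
    simp only [Prod.mk_sub_mk, sub_self] at this
    exact sub_eq_zero.1 (hzT _ this)
  refine ⟨e, ?_, ?_, ?_⟩
  · intro c s
    exact huniq _ _ (hGS c _ (hmem s))
  · intro c s
    exact huniq _ _ (hGH c _ (hmem s))
  · intro j s hs
    apply T.mem_of_pr
    intro k hk
    apply hzT
    have := hGg k _ (hmem s)
    simp only [S.pr_ne j k s hk hs] at this
    exact this

/-- Simultaneous separation from a finite list of homogeneous vectors. -/
theorem exists_sep_list
    (hF : ∀ x : F, ∃ a b : A, algebraMap A F b ≠ 0 ∧ x * algebraMap A F b = algebraMap A F a)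
    (S : GrMod A H 𝒜 F) (hS : S.GrSimple)
    (i : ℤ) (x : S.carrier) (hx : x ∈ S.grading i) (hx0 : x ≠ 0)
    (l : List (Σ T : GrMod A H 𝒜 F, T.grading i))
    (hl : ∀ z ∈ l, z.1.GrSimple ∧ ¬ S.GrIso z.1) :
    ∃ (c : F) (h : H), h ∈ 𝒜 0 ∧ c • h • x = x ∧ ∀ z ∈ l, h • (z.2 : z.1.carrier) = 0 := by
  induction l with
  | nil => exact ⟨1, 1, SetLike.GradedOne.one_mem, by simp, by simp⟩
  | cons z l ih =>
    obtain ⟨c, h, hh, hc, hz⟩ := ih fun w hw => hl w (List.mem_cons_of_mem _ hw)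
    have h1 : h • (z.2 : z.1.carrier) ∈ z.1.grading i := by
      simpa using z.1.grading_smul 0 i h hh _ z.2.2
    obtain ⟨hz1, hz2⟩ := hl z List.mem_cons_self
    obtain ⟨c', h', hh', hc', hz'⟩ := exists_sep hF S z.1 hS hz1 hz2 i x hx hx0 _ h1
    refine ⟨c' * c, h' * h, ?_, ?_, ?_⟩
    · simpa using SetLike.GradedMul.mul_mem hh' hh
    · rw [mul_smul, mul_smul, ← S.smul_comm' h' c, hc, hc']
    · intro w hw
      rw [mul_smul]
      rcases List.mem_cons.1 hw with rfl | hw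
      · exact hz'
      · rw [hz w hw, smul_zero]

/-- Separation from a finite multiset of graded-simple modules. -/
theorem exists_sep_multiset
    (hF : ∀ x : F, ∃ a b : A, algebraMap A F b ≠ 0 ∧ x * algebraMap A F b = algebraMap A F a)
    (S : GrMod A H 𝒜 F) (hS : S.GrSimple)
    (i : ℤ) (x : S.carrier) (hx : x ∈ S.grading i) (hx0 : x ≠ 0)
    (t : Multiset (GrMod A H 𝒜 F)) (ht : ∀ T ∈ t, T.GrSimple ∧ ¬ S.GrIso T) :
    ∃ (c : F) (h : H), h ∈ 𝒜 0 ∧ c • h • x = x ∧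
      ∀ T ∈ t, ∀ y ∈ T.grading i, h • y = 0 := by
  classical
  obtain ⟨l, rfl⟩ : ∃ l : List (GrMod A H 𝒜 F), (l : Multiset _) = t := Quot.exists_rep t
  have hfin : ∀ T : GrMod A H 𝒜 F, ∃ s : Finset (T.grading i),
      Submodule.span F (s : Set (T.grading i)) = ⊤ := fun T =>
    (inferInstance : Module.Finite F (T.grading i)).fg_top
  choose s hs using hfin
  obtain ⟨c, h, hh, hc, hz⟩ := exists_sep_list hF S hS i x hx hx0
    (l.flatMap fun T => (s T).toList.map fun y => ⟨T, y⟩) (by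
      intro z hz
      simp only [List.mem_flatMap, List.mem_map] at hz
      obtain ⟨T, hT, y, -, rfl⟩ := hz
      exact ht T hT)
  refine ⟨c, h, hh, hc, ?_⟩
  intro T hT y hy
  have h1 : (⟨y, hy⟩ : T.grading i) ∈ Submodule.span F (s T : Set (T.grading i)) := by
    rw [hs T]; trivial
  have h2 : Submodule.span F (s T : Set (T.grading i)) ≤
      LinearMap.ker (T.degAct ⟨h, hh⟩ i) := by
    rw [Submodule.span_le]
    intro w hw
    apply Subtype.ext
    exact hz ⟨T, w⟩ (by
      simp only [List.mem_flatMap, List.mem_map]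
      exact ⟨T, hT, w, by simpa using hw, rfl⟩)
  exact congrArg Subtype.val (h2 h1)

theorem cpoly_contra
    (hF : ∀ x : F, ∃ a b : A, algebraMap A F b ≠ 0 ∧ x * algebraMap A F b = algebraMap A F a)
    (S : GrMod A H 𝒜 F) (hS : S.GrSimple) (s t : Multiset (GrMod A H 𝒜 F)) (hSs : S ∈ s)
    (ht : ∀ T ∈ t, T.GrSimple ∧ ¬ S.GrIso T)
    (heq : ∀ (h : 𝒜 0) (i : ℤ), (s.map fun S => S.cpoly h i).prod =
      (t.map fun S => S.cpoly h i).prod) : False := by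
  obtain ⟨z, hz⟩ := @exists_ne _ hS.1 (0 : S.carrier)
  have : ∃ i, S.pr i z ≠ 0 := by
    by_contra hcon
    push Not at hcon
    exact hz (S.pr_ext _ _ fun i => by rw [hcon i, map_zero])
  obtain ⟨i, hi⟩ := this
  obtain ⟨c, h, hh, hc, hT⟩ := exists_sep_multiset hF S hS i _ (S.pr_mem i z) hi t ht
  have hc0 : c ≠ 0 := by
    rintro rfl
    rw [zero_smul] at hc
    exact hi hc.symm
  have hr : (S.cpoly ⟨h, hh⟩ i).IsRoot c⁻¹ := by
    rw [GrMod.cpoly, ← Module.End.hasEigenvalue_iff_isRoot_charpoly]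
    refine Module.End.hasEigenvalue_of_hasEigenvector
      (x := ⟨S.pr i z, S.pr_mem i z⟩) ⟨?_, ?_⟩
    · rw [Module.End.mem_eigenspace_iff]
      apply Subtype.ext
      change h • S.pr i z = c⁻¹ • S.pr i z
      rw [eq_inv_smul_iff₀ hc0, hc]
    · intro h0
      exact hi (congrArg Subtype.val h0)
  have h1 : ((s.map fun S : GrMod A H 𝒜 F => S.cpoly ⟨h, hh⟩ i).prod).eval c⁻¹ = 0 := by
    rw [Polynomial.eval_multiset_prod, Multiset.prod_eq_zero_iff, Multiset.map_map,
      Multiset.mem_map]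
    exact ⟨S, hSs, hr⟩
  rw [heq, Polynomial.eval_multiset_prod, Multiset.prod_eq_zero_iff, Multiset.map_map,
      Multiset.mem_map] at h1
  obtain ⟨T, hTt, hT0⟩ := h1
  have h2 : T.degAct ⟨h, hh⟩ i = 0 := by
    ext w
    exact hT T hTt w w.2
  simp only [Function.comp_apply, GrMod.cpoly, h2, LinearMap.charpoly_zero,
    Polynomial.eval_pow, Polynomial.eval_X] at hT0
  exact pow_ne_zero _ (inv_ne_zero hc0) hT0

theorem cls_eq_of_multiset
    (hF : ∀ x : F, ∃ a b : A, algebraMap A F b ≠ 0 ∧ x * algebraMap A F b = algebraMap A F a)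
    (n : ℕ) : ∀ (s t : Multiset (GrMod A H 𝒜 F)), s.card = n →
    (∀ S ∈ s, S.GrSimple) → (∀ S ∈ t, S.GrSimple) →
    (∀ (h : 𝒜 0) (i : ℤ), (s.map fun S => S.cpoly h i).prod =
      (t.map fun S => S.cpoly h i).prod) → (s.map cls).sum = (t.map cls).sum := by
  induction n with
  | zero =>
    intro s t hn hs ht heq
    obtain rfl := Multiset.card_eq_zero.1 hn
    rcases t.empty_or_exists_mem with rfl | ⟨T, hT⟩
    · rfl
    · exact (cpoly_contra hF T (ht T hT) t 0 hT (by simp) fun h i => (heq h i).symm).elim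
  | succ n ih =>
    intro s t hn hs ht heq
    obtain ⟨S, hSs⟩ : ∃ S, S ∈ s := Multiset.card_pos_iff_exists_mem.1 (by omega)
    by_cases hex : ∃ T ∈ t, S.GrIso T
    · obtain ⟨T, hTt, hST⟩ := hex
      obtain ⟨s, rfl⟩ := Multiset.exists_cons_of_mem hSs
      obtain ⟨t, rfl⟩ := Multiset.exists_cons_of_mem hTt
      rw [Multiset.map_cons, Multiset.map_cons, Multiset.sum_cons, Multiset.sum_cons,
        cls_iso hST]
      congr 1
      refine ih s t (by simpa using hn) (fun S hS => hs S (Multiset.mem_cons_of_mem hS))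
        (fun S hS => ht S (Multiset.mem_cons_of_mem hS)) fun h i => ?_
      have := heq h i
      rw [Multiset.map_cons, Multiset.map_cons, Multiset.prod_cons, Multiset.prod_cons,
        cpoly_iso hST] at this
      exact mul_left_cancel₀ (LinearMap.charpoly_monic _).ne_zero this
    · push Not at hex
      exact (cpoly_contra hF S (hs S hSs) s t hSs (fun T hT => ⟨ht T hT, hex T hT⟩) heq).elim

/-- Graded Brauer–Nesbitt. -/
theorem cls_eq_of_cpoly
    (hF : ∀ x : F, ∃ a b : A, algebraMap A F b ≠ 0 ∧ x * algebraMap A F b = algebraMap A F a)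
    (V W : GrMod A H 𝒜 F) (heq : ∀ (h : 𝒜 0) (i : ℤ), V.cpoly h i = W.cpoly h i) :
    V.cls = W.cls := by
  obtain ⟨s, a1, b1, c1⟩ := exists_factors _ V rfl
  obtain ⟨t, a2, b2, c2⟩ := exists_factors _ W rfl
  rw [b1, b2]
  refine cls_eq_of_multiset hF _ s t rfl a1 a2 fun h i => ?_
  rw [← c1, ← c2, heq]

theorem cpoly_coeff_integral [Module.Finite A H] (V : GrMod A H 𝒜 F) (h : 𝒜 0) (i : ℤ)
    (m : ℕ) : IsIntegral A ((V.cpoly h i).coeff m) := by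
  obtain ⟨p, hp, hph⟩ : IsIntegral A (h : H) := IsIntegral.of_finite A (h : H)
  refine aux_charpoly_integral _ p hp ?_ m
  have key : ∀ (q : Polynomial A) (x : V.grading i),
      ((Polynomial.aeval (R := F) (V.degAct h i : Module.End F (V.grading i))
        (q.map (algebraMap A F)) x : V.grading i) : V.carrier) =
      (Polynomial.aeval (h : H) q) • (x : V.carrier) := by
    intro q
    induction q using Polynomial.induction_on' with
    | add p q hp hq =>
      intro x
      simp [hp, hq, add_smul]
    | monomial n a =>
      intro x
      have hpow : ∀ n : ℕ, ((((V.degAct h i : Module.End F (V.grading i)) ^ n) x :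
          V.grading i) : V.carrier) = (h : H) ^ n • (x : V.carrier) := by
        intro n
        induction n with
        | zero => simp
        | succ n ih =>
          rw [pow_succ', Module.End.mul_apply, pow_succ', mul_smul, ← ih]
          rfl
      rw [Polynomial.map_monomial, Polynomial.aeval_monomial, Polynomial.aeval_monomial,
        mul_smul, V.compat, ← hpow n, Module.End.mul_apply]
      rfl
  ext x
  rw [key p x]
  have h0 : Polynomial.aeval (h : H) p = 0 := hph
  rw [h0]
  simp

end GrMod

end GrAux2

/-- factorization of graded decomposition maps. Let `θ : A → L` and
`θ' : A → L'` be specializations with `Ker θ ⊆ Ker θ'`, `φ : θ(A) → L'` the induced map with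
`φ ∘ θ = θ'`, extended to a ring `B` with `θ(A) ⊆ B ⊆ L` integrally closed in `L`, and let
`LH` and `L'H` be split.  If `d^gr_θ`, `d^gr_{θ'}` and `d^gr_{θ,θ'}` are the graded
decomposition maps (characterized by the commutation of the `p`/`t` diagrams), then
`d^gr_{θ'} = d^gr_{θ,θ'} ∘ d^gr_θ`. -/
theorem factorization_graded_decomposition_maps
    (A : Type u) [CommRing A] [IsDomain A] [IsIntegrallyClosed A]
    (K : Type u) [Field K] [Algebra A K] [IsFractionRing A K]
    (H : Type u) [Ring H] [Algebra A H] [Module.Free A H] [Module.Finite A H]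
    (𝒜 : ℤ → Submodule A H) [GradedAlgebra 𝒜]
    (L : Type u) [Field L] [Algebra A L]
    (L' : Type u) [Field L'] [Algebra A L']
    (hLfrac : ∀ x : L, ∃ a b : A,
      algebraMap A L b ≠ 0 ∧ x * algebraMap A L b = algebraMap A L a)
    (hL'frac : ∀ x : L', ∃ a b : A,
      algebraMap A L' b ≠ 0 ∧ x * algebraMap A L' b = algebraMap A L' a)
    (hker : ∀ a : A, algebraMap A L a = 0 → algebraMap A L' a = 0)
    (B : Subring L) (hθB : ∀ a : A, algebraMap A L a ∈ B)
    (φ : B →+* L') (hφθ : ∀ a : A, φ ⟨algebraMap A L a, hθB a⟩ = algebraMap A L' a)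
    (hBclosed : ∀ x : L,
      (∃ p : Polynomial B, p.Monic ∧ Polynomial.eval₂ B.subtype x p = 0) → x ∈ B)
    (hsplitL : SplitAlg A H L) (hsplitL' : SplitAlg A H L')
    (dθ : Groth A H 𝒜 K →+ Groth A H 𝒜 L)
    (hdθ : ∀ V : GrMod A H 𝒜 K, ∃ Y : GrMod A H 𝒜 L, dθ V.cls = Y.cls ∧
      ∀ (h : 𝒜 0) (i : ℤ) (m : ℕ) (a : A),
        (V.cpoly h i).coeff m = algebraMap A K a →
          (Y.cpoly h i).coeff m = algebraMap A L a)
    (dθ' : Groth A H 𝒜 K →+ Groth A H 𝒜 L')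
    (hdθ' : ∀ V : GrMod A H 𝒜 K, ∃ Z : GrMod A H 𝒜 L', dθ' V.cls = Z.cls ∧
      ∀ (h : 𝒜 0) (i : ℤ) (m : ℕ) (a : A),
        (V.cpoly h i).coeff m = algebraMap A K a →
          (Z.cpoly h i).coeff m = algebraMap A L' a)
    (dθθ' : Groth A H 𝒜 L →+ Groth A H 𝒜 L')
    (hdθθ' : ∀ Y : GrMod A H 𝒜 L, ∃ Z : GrMod A H 𝒜 L', dθθ' Y.cls = Z.cls ∧
      ∀ (h : 𝒜 0) (i : ℤ) (m : ℕ) (b : B),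
        (Y.cpoly h i).coeff m = (b : L) → (Z.cpoly h i).coeff m = φ b) :
    dθ' = dθθ'.comp dθ := by
  suffices hV : ∀ V : GrMod A H 𝒜 K, dθ' V.cls = dθθ' (dθ V.cls) by
    apply AddMonoidHom.ext
    intro z
    obtain ⟨z, rfl⟩ := QuotientAddGroup.mk_surjective z
    induction z using FreeAbelianGroup.induction_on with
    | zero => exact (map_zero dθ').trans (map_zero (dθθ'.comp dθ)).symm
    | of V => exact hV V
    | neg V hV =>
      exact (map_neg dθ' V.cls).trans ((congrArg Neg.neg hV).trans
        (map_neg (dθθ'.comp dθ) V.cls).symm)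
    | add x y hx hy =>
      exact (map_add dθ' (QuotientAddGroup.mk x) (QuotientAddGroup.mk y)).trans
        ((congrArg₂ (· + ·) hx hy).trans
        (map_add (dθθ'.comp dθ) (QuotientAddGroup.mk x) (QuotientAddGroup.mk y)).symm)
  intro V
  obtain ⟨Y, hY, cY⟩ := hdθ V
  obtain ⟨Z, hZ, cZ⟩ := hdθ' V
  obtain ⟨Z', hZ', cZ'⟩ := hdθθ' Y
  rw [hY, hZ, hZ']
  refine GrMod.cls_eq_of_cpoly hL'frac Z Z' fun h i => ?_
  ext m
  obtain ⟨a, ha⟩ := IsIntegrallyClosed.isIntegral_iff.1 (V.cpoly_coeff_integral h i m)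
  rw [cZ h i m a ha.symm, cZ' h i m ⟨algebraMap A L a, hθB a⟩ (cY h i m a ha.symm), hφθ]
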